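/- arXiv:2205.00008 — 2 statements merged into one kernel-verified Lean document; each statement's English description precedes it below -/
import Mathlib

section
/- Let (C, L) be a connected tree-like nodal curve with rational components and deg(L) ≥ −1. Then (C, L) is non-special (i.e., h^0(C, L) = deg(L) + 1) if and only if (i) h^0(C_+, L_+) = χ(C_+, L_+), and (ii) every component degree d_i ≥ −1 and no two components with negative degree intersect. -/
open scoped BigOperators

/-- Evaluation of a binary form with `n` coefficients (degree `n - 1`) at the point `(a, b)`,
as a linear functional on the coefficient space. -/
noncomputable def evalForm (n : ℕ) (a b : ℂ) : (Fin n → ℂ) →ₗ[ℂ] ℂ :=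
  ∑ i : Fin n, (a ^ (i : ℕ) * b ^ (n - 1 - (i : ℕ))) • LinearMap.proj i

/-- The gluing condition at a node joining components `i` and `j`, with node coordinates
`p` on component `i` and `q` on component `j`. -/
noncomputable def glueCond {I : Type*} (m : I → ℕ) (i j : I) (p q : ℂ × ℂ) :
    (∀ k, Fin (m k) → ℂ) →ₗ[ℂ] ℂ :=
  (evalForm (m i) p.1 p.2).comp
      (LinearMap.proj i : (∀ k, Fin (m k) → ℂ) →ₗ[ℂ] (Fin (m i) → ℂ)) -
    (evalForm (m j) q.1 q.2).comp
      (LinearMap.proj j : (∀ k, Fin (m k) → ℂ) →ₗ[ℂ] (Fin (m j) → ℂ))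

/-- The space of global sections of a line bundle on a nodal curve with rational components:
the dual graph is `G`, component `i` carries sections with `m i` coefficients
(i.e. degree `m i - 1`), and for each edge the sections agree at the node. -/
noncomputable def nodalSections {I : Type*} (G : SimpleGraph I) (m : I → ℕ)
    (node : ∀ i j, G.Adj i j → ℂ × ℂ) : Submodule ℂ (∀ k, Fin (m k) → ℂ) :=
  ⨅ (i) (j) (h : G.Adj i j),
    LinearMap.ker (glueCond m i j (node i j h) (node j i h.symm))

/-- The nodes are genuine points of `ℙ¹` (nonzero coordinates) and the nodes lying on one
and the same component are pairwise distinct as points of `ℙ¹`. -/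
def NodesOk {I : Type*} (G : SimpleGraph I) (node : ∀ i j, G.Adj i j → ℂ × ℂ) : Prop :=
  (∀ i j (h : G.Adj i j), node i j h ≠ 0) ∧
    ∀ i j j' (h : G.Adj i j) (h' : G.Adj i j'), j ≠ j' →
      (node i j h).1 * (node i j' h').2 ≠ (node i j' h').1 * (node i j h).2

/-- The number of nodes joining component `i` to components of negative degree. -/
def eNeg {I : Type*} [Fintype I] (G : SimpleGraph I) [DecidableRel G.Adj]
    (d : I → ℤ) (i : I) : ℕ :=
  (Finset.univ.filter fun j => G.Adj i j ∧ d j < 0).card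


def mulLin (n : ℕ) (a b : ℂ) : (Fin n → ℂ) →ₗ[ℂ] (Fin (n+1) → ℂ) where
  toFun g := fun k => b * (Fin.cons 0 g : Fin (n+1) → ℂ) k - a * (Fin.snoc g 0 : Fin (n+1) → ℂ) k
  map_add' g h := by
    funext k
    have h1 : (Fin.cons 0 (g+h) : Fin (n+1) → ℂ) k
        = (Fin.cons 0 g : Fin (n+1) → ℂ) k + (Fin.cons 0 h : Fin (n+1) → ℂ) k := by
      refine Fin.cases ?_ (fun i => ?_) k <;> simp
    have h2 : (Fin.snoc (g+h) 0 : Fin (n+1) → ℂ) k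
        = (Fin.snoc g 0 : Fin (n+1) → ℂ) k + (Fin.snoc h 0 : Fin (n+1) → ℂ) k := by
      refine Fin.lastCases ?_ (fun i => ?_) k <;> simp
    simp only [Pi.add_apply]
    rw [h1, h2]; ring
  map_smul' c g := by
    funext k
    have h1 : (Fin.cons 0 (c • g) : Fin (n+1) → ℂ) k = c * (Fin.cons 0 g : Fin (n+1) → ℂ) k := by
      refine Fin.cases ?_ (fun i => ?_) k <;> simp
    have h2 : (Fin.snoc (c • g) 0 : Fin (n+1) → ℂ) k = c * (Fin.snoc g 0 : Fin (n+1) → ℂ) k := by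
      refine Fin.lastCases ?_ (fun i => ?_) k <;> simp
    simp only [Pi.smul_apply, smul_eq_mul, RingHom.id_apply]
    rw [h1, h2]; ring

lemma evalForm_apply (n : ℕ) (a b : ℂ) (f : Fin n → ℂ) :
    evalForm n a b f = ∑ i : Fin n, a ^ (i : ℕ) * b ^ (n - 1 - (i : ℕ)) * f i := by
  simp [evalForm]

lemma eval_mulLin (n : ℕ) (a b x y : ℂ) (g : Fin n → ℂ) :
    evalForm (n+1) x y (mulLin n a b g) = (b * x - a * y) * evalForm n x y g := by
  rw [evalForm_apply, evalForm_apply]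
  simp only [mulLin, LinearMap.coe_mk, AddHom.coe_mk, mul_sub, Finset.sum_sub_distrib]
  rw [Fin.sum_univ_succ (fun k : Fin (n+1) => x ^ (k:ℕ) * y ^ (n + 1 - 1 - (k:ℕ)) *
      (b * (Fin.cons 0 g : Fin (n+1) → ℂ) k)),
    Fin.sum_univ_castSucc (fun k : Fin (n+1) => x ^ (k:ℕ) * y ^ (n + 1 - 1 - (k:ℕ)) *
      (a * (Fin.snoc g 0 : Fin (n+1) → ℂ) k))]
  simp only [Fin.cons_zero, Fin.cons_succ, Fin.snoc_castSucc, Fin.snoc_last, mul_zero, zero_add,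
    add_zero, Fin.val_succ, Fin.val_castSucc]
  rw [sub_mul, Finset.mul_sum, Finset.mul_sum]
  congr 1
  · refine Finset.sum_congr rfl fun i _ => ?_
    have : n + 1 - 1 - ((i:ℕ) + 1) = n - 1 - i := by omega
    rw [this]; ring
  · refine Finset.sum_congr rfl fun i _ => ?_
    have : n + 1 - 1 - (i:ℕ) = n - 1 - i + 1 := by omega
    rw [this]; ring

lemma mulLin_inj (n : ℕ) (a b : ℂ) (h : (a, b) ≠ 0) : Function.Injective (mulLin n a b) := by
  rw [← LinearMap.ker_eq_bot, LinearMap.ker_eq_bot']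
  intro g hg
  have key : ∀ k, b * (Fin.cons 0 g : Fin (n+1) → ℂ) k = a * (Fin.snoc g 0 : Fin (n+1) → ℂ) k :=
    fun k => sub_eq_zero.1 (congrFun hg k)
  by_cases ha : a = 0
  · subst ha
    have hb : b ≠ 0 := by rintro rfl; exact h rfl
    funext i
    have := key i.succ
    simpa [hb] using this
  · have : ∀ j (hj : j < n), g ⟨j, hj⟩ = 0 := by
      intro j
      induction j with
      | zero =>
        intro hj
        have := key (Fin.castSucc ⟨0, hj⟩)
        rw [Fin.snoc_castSucc] at this
        have h0 : Fin.castSucc (⟨0, hj⟩ : Fin n) = 0 := rfl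
        rw [h0, Fin.cons_zero] at this
        simpa [ha] using this.symm
      | succ j ih =>
        intro hj
        have := key (Fin.castSucc ⟨j+1, hj⟩)
        rw [Fin.snoc_castSucc] at this
        have h0 : Fin.castSucc (⟨j+1, hj⟩ : Fin n) = Fin.succ ⟨j, by omega⟩ := rfl
        rw [h0, Fin.cons_succ, ih] at this
        simpa [ha] using this.symm
    funext i
    exact this i i.2

lemma evalForm_ne_zero (n : ℕ) (a b : ℂ) (h : (a, b) ≠ 0) : evalForm (n+1) a b ≠ 0 := by
  intro h0
  have key : ∀ k : Fin (n+1), a ^ (k:ℕ) * b ^ (n - (k:ℕ)) = 0 := by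
    intro k
    have := congrArg (fun φ => φ (Pi.single k 1)) h0
    simpa [evalForm_apply, Pi.single_apply] using this
  have h1 := key 0
  have h2 := key (Fin.last n)
  simp at h1 h2
  exact h (by rw [h1.1, h2.1]; rfl)

lemma range_mulLin (n : ℕ) (a b : ℂ) (h : (a, b) ≠ 0) :
    LinearMap.range (mulLin n a b) = LinearMap.ker (evalForm (n+1) a b) := by
  apply Submodule.eq_of_le_of_finrank_eq
  · rintro _ ⟨g, rfl⟩
    rw [LinearMap.mem_ker, eval_mulLin]; ring
  · rw [LinearMap.finrank_range_of_inj (mulLin_inj n a b h)]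
    have := LinearMap.finrank_range_add_finrank_ker (evalForm (n+1) a b)
    have h2 : LinearMap.range (evalForm (n+1) a b) = ⊤ :=
      LinearMap.range_eq_top.2 (LinearMap.surjective (evalForm_ne_zero n a b h))
    rw [h2] at this
    simp at this ⊢
    omega

lemma vanish {J : Type*} [DecidableEq J] (p : J → ℂ × ℂ) (n : ℕ) (S : Finset J)
    (h0 : ∀ j ∈ S, p j ≠ 0)
    (hd : ∀ j ∈ S, ∀ j' ∈ S, j ≠ j' → (p j).1 * (p j').2 ≠ (p j').1 * (p j).2) :
    ∀ k, k = n - S.card → ∃ (M : (Fin k → ℂ) →ₗ[ℂ] (Fin n → ℂ)) (P : ℂ × ℂ → ℂ),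
      Function.Injective M ∧
      (∀ f, (∀ j ∈ S, evalForm n (p j).1 (p j).2 f = 0) → ∃ g, M g = f) ∧
      (∀ g, ∀ j ∈ S, evalForm n (p j).1 (p j).2 (M g) = 0) ∧
      (∀ q : ℂ × ℂ, (∀ j ∈ S, q.1 * (p j).2 ≠ (p j).1 * q.2) → P q ≠ 0) ∧
      ∀ g (q : ℂ × ℂ), evalForm n q.1 q.2 (M g) = P q * evalForm k q.1 q.2 g := by
  induction S using Finset.induction_on with
  | empty =>
    intro k hk
    simp at hk
    subst hk
    exact ⟨LinearMap.id, fun _ => 1, fun _ _ h => h, fun f _ => ⟨f, rfl⟩, by simp, by simp, by simp⟩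
  | insert j S hj ih =>
    intro k hk
    obtain ⟨M, P, hM, hsurj, hvan, hP, hev⟩ := ih (fun i hi => h0 i (by simp [hi]))
      (fun i hi i' hi' => hd i (by simp [hi]) i' (by simp [hi'])) _ rfl
    rw [Finset.card_insert_of_notMem hj] at hk
    have hPj : P (p j) ≠ 0 := hP _ fun i hi =>
      hd j (by simp) i (by simp [hi]) (by rintro rfl; exact hj hi)
    generalize hk' : n - S.card = k' at *
    rcases k' with _ | k'
    · have : k = 0 := by omega
      subst this
      refine ⟨M, P, hM, fun f hf => hsurj f fun i hi => hf i (by simp [hi]), ?_, ?_, hev⟩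
      · intro g i hi
        rw [Subsingleton.elim g 0, map_zero, map_zero]
      · intro q hq; exact hP q fun i hi => hq i (by simp [hi])
    · have : k = k' := by omega
      subst this
      have hpj : ((p j).1, (p j).2) ≠ 0 := h0 j (by simp)
      refine ⟨M ∘ₗ mulLin k (p j).1 (p j).2, fun q => P q * ((p j).2 * q.1 - (p j).1 * q.2),
        hM.comp (mulLin_inj _ _ _ hpj), ?_, ?_, ?_, ?_⟩
      · intro f hf
        obtain ⟨g, rfl⟩ := hsurj f fun i hi => hf i (by simp [hi])
        have h1 := hf j (by simp)
        rw [hev] at h1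
        have h2 : g ∈ LinearMap.ker (evalForm (k+1) (p j).1 (p j).2) := by
          simpa [hPj] using h1
        rw [← range_mulLin _ _ _ hpj] at h2
        obtain ⟨g', rfl⟩ := h2
        exact ⟨g', rfl⟩
      · intro g i hi
        rcases Finset.mem_insert.1 hi with rfl | hi
        · rw [LinearMap.comp_apply, hev, eval_mulLin]; ring
        · exact hvan _ i hi
      · intro q hq
        refine mul_ne_zero (hP q fun i hi => hq i (by simp [hi])) ?_
        rw [sub_ne_zero, mul_comm]
        exact hq j (by simp)
      · intro g q
        rw [LinearMap.comp_apply, hev, eval_mulLin]; ring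

noncomputable def walkWt {I : Type*} {G : SimpleGraph I} (w : I → I → ℂ) :
    ∀ {i r : I}, G.Walk i r → ℂ
  | _, _, .nil => 1
  | i, _, .cons (v := j) _ p => w j i / w i j * walkWt w p

lemma walkWt_ne_zero {I : Type*} {G : SimpleGraph I} (w : I → I → ℂ)
    (hw : ∀ i j, G.Adj i j → w i j ≠ 0) {i r : I} (p : G.Walk i r) : walkWt w p ≠ 0 := by
  induction p with
  | nil => simp [walkWt]
  | cons h p ih => exact mul_ne_zero (div_ne_zero (hw _ _ h.symm) (hw _ _ h)) ih

lemma exists_scale {I : Type*} {G : SimpleGraph I} (hG : G.IsTree) (w : I → I → ℂ)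
    (hw : ∀ i j, G.Adj i j → w i j ≠ 0) :
    ∃ c : I → ℂ, (∀ i, c i ≠ 0) ∧ ∀ i j, G.Adj i j → c i * w i j = c j * w j i := by
  classical
  obtain ⟨r⟩ := hG.connected.nonempty
  choose q hq hu using fun i => hG.existsUnique_path i r
  refine ⟨fun i => walkWt w (q i), fun i => walkWt_ne_zero w hw _, ?_⟩
  have main : ∀ i j, G.Adj i j → i ∉ (q j).support →
      walkWt w (q i) * w i j = walkWt w (q j) * w j i := by
    intro i j h hi
    have : q i = .cons h (q j) := (hu i _ ((hq j).cons hi)).symm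
    rw [this]
    simp only [walkWt]
    have := hw i j h
    field_simp
  intro i j h
  by_cases hi : i ∈ (q j).support
  · by_cases hj : j ∈ (q i).support
    · exfalso
      have h1 : (q j).dropUntil i hi = q i := hu i _ ((hq j).dropUntil hi)
      have h2 : (q i).dropUntil j hj = q j := hu j _ ((hq i).dropUntil hj)
      have h3 := SimpleGraph.Walk.length_dropUntil_lt_length hi h.ne
      have h4 := SimpleGraph.Walk.length_dropUntil_lt_length hj h.ne'
      rw [h1] at h3; rw [h2] at h4; omega
    · exact (main j i h.symm hj).symm
  · exact main i j h hi

lemma glueCond_swap {I : Type*} (m : I → ℕ) (i j : I) (p q : ℂ × ℂ) :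
    glueCond m i j p q = - glueCond m j i q p := by
  simp [glueCond]

lemma mem_nodal {I : Type*} (G : SimpleGraph I) (m : I → ℕ)
    (node : ∀ i j, G.Adj i j → ℂ × ℂ) (s : ∀ k, Fin (m k) → ℂ) :
    s ∈ nodalSections G m node ↔ ∀ i j (h : G.Adj i j),
      evalForm (m i) (node i j h).1 (node i j h).2 (s i) =
        evalForm (m j) (node j i h.symm).1 (node j i h.symm).2 (s j) := by
  simp [nodalSections, glueCond, sub_eq_zero]

lemma dim_bound {I : Type*} [Fintype I] (G : SimpleGraph I) (m : I → ℕ)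
    (node : ∀ i j, G.Adj i j → ℂ × ℂ) :
    ∑ i, m i ≤ Module.finrank ℂ ↥(nodalSections G m node) + Nat.card G.edgeSet := by
  classical
  have hex : ∀ e : G.edgeSet, ∃ a b, G.Adj a b ∧ s(a, b) = e.1 := by
    rintro ⟨e, he⟩
    induction e using Sym2.ind with
    | _ a b => exact ⟨a, b, he, rfl⟩
  choose ea eb hout heq using hex
  let φ : (∀ k, Fin (m k) → ℂ) →ₗ[ℂ] (G.edgeSet → ℂ) :=
    LinearMap.pi fun e => glueCond m (ea e) (eb e) (node _ _ (hout e)) (node _ _ (hout e).symm)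
  have hker : LinearMap.ker φ ≤ nodalSections G m node := by
    intro s hs
    rw [mem_nodal]
    intro i j h
    have h1 := congrFun (LinearMap.mem_ker.1 hs) ⟨s(i, j), h⟩
    have key : ∀ (a b : I) (hab : G.Adj a b), s(a, b) = s(i, j) →
        glueCond m a b (node a b hab) (node b a hab.symm) s = 0 →
        glueCond m i j (node i j h) (node j i h.symm) s = 0 := by
      intro a b hab he h0
      rcases Sym2.eq_iff.1 he with ⟨rfl, rfl⟩ | ⟨rfl, rfl⟩
      · exact h0
      · rw [glueCond_swap]; simpa using h0
    have h2 := key _ _ (hout ⟨s(i, j), h⟩) (heq _) h1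
    simpa [glueCond, sub_eq_zero] using h2
  have h1 := LinearMap.finrank_range_add_finrank_ker φ
  have h2 := Submodule.finrank_mono hker
  have h3 := Submodule.finrank_le (LinearMap.range φ)
  rw [Module.finrank_fintype_fun_eq_card, ← Nat.card_eq_fintype_card] at h3
  have h4 : Module.finrank ℂ (∀ k, Fin (m k) → ℂ) = ∑ i, m i := by
    rw [Module.finrank_pi_fintype]; simp
  omega

lemma forest_count {V : Type*} [Fintype V] (H : SimpleGraph V) (hH : H.IsAcyclic) :
    Nat.card H.edgeSet + Nat.card H.ConnectedComponent = Fintype.card V := by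
  classical
  have hs := H.sum_degrees_eq_twice_card_edges
  have h1 : ∀ c : H.ConnectedComponent,
      ∑ v : {v // H.connectedComponentMk v = c}, H.degree v.1 + 2 =
        2 * Fintype.card {v // H.connectedComponentMk v = c} := by
    intro c
    have hT : (H.induce {v | H.connectedComponentMk v = c}).IsTree :=
      hH.isTree_connectedComponent c
    have h2 := hT.card_edgeFinset
    have h3 := (H.induce {v | H.connectedComponentMk v = c}).sum_degrees_eq_twice_card_edges
    have h4 : ∀ v : {v // H.connectedComponentMk v = c},
        (H.induce {v | H.connectedComponentMk v = c}).degree v = H.degree v.1 := by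
      intro v
      rw [← SimpleGraph.card_neighborFinset_eq_degree, ← SimpleGraph.card_neighborFinset_eq_degree]
      refine Finset.card_bij (fun a _ => a.1) ?_ ?_ ?_
      · intro a ha
        simpa using ha
      · intro a _ b _ h; exact Subtype.ext h
      · intro b hb
        simp at hb
        refine ⟨⟨b, ?_⟩, by simpa using hb, rfl⟩
        exact (SimpleGraph.ConnectedComponent.sound hb.reachable).symm.trans v.2
    have h5 : ∑ v : {v // H.connectedComponentMk v = c}, H.degree v.1 =
        2 * (H.induce {v | H.connectedComponentMk v = c}).edgeFinset.card := by
      rw [← h3]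
      exact Finset.sum_congr rfl fun v _ => (h4 v).symm
    have h6 : Fintype.card {v // H.connectedComponentMk v = c}
      = Fintype.card ↑{v | H.connectedComponentMk v = c} := rfl
    omega
  have h7 : ∑ v, H.degree v =
      ∑ c : H.ConnectedComponent, ∑ v : {v // H.connectedComponentMk v = c}, H.degree v.1 :=
    (Fintype.sum_fiberwise H.connectedComponentMk _).symm
  have h8 : Fintype.card V =
      ∑ c : H.ConnectedComponent, Fintype.card {v // H.connectedComponentMk v = c} := by
    rw [← Fintype.card_sigma]
    exact (Fintype.card_congr (Equiv.sigmaFiberEquiv H.connectedComponentMk)).symm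
  have h9 := Finset.sum_congr (rfl : (Finset.univ : Finset H.ConnectedComponent) = _)
    (fun c _ => h1 c)
  rw [Finset.sum_add_distrib, ← h7, ← Finset.mul_sum, ← h8] at h9
  simp only [Finset.sum_const, Finset.card_univ, smul_eq_mul] at h9
  rw [Nat.card_eq_fintype_card, Nat.card_eq_fintype_card, ← SimpleGraph.edgeFinset_card]
  omega

lemma finrank_eq {I : Type} [Fintype I] [DecidableEq I]
    (G : SimpleGraph I) [DecidableRel G.Adj] (hG : G.IsTree) (d : I → ℤ)
    (node : ∀ i j, G.Adj i j → ℂ × ℂ) (hnode : NodesOk G node) :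
    Module.finrank ℂ ↥(nodalSections G (fun i => (d i + 1).toNat) node) =
      Module.finrank ℂ
            ↥(nodalSections (G.comap (Subtype.val : {i : I // 0 ≤ d i} → I))
              (fun i => (d i.1 - (eNeg G d i.1 : ℤ) + 1).toNat)
              (fun i j h => node i.1 j.1 h)) := by
  classical
  have hV : ∀ i : I, ∃ (M : (Fin (d i - (eNeg G d i : ℤ) + 1).toNat → ℂ) →ₗ[ℂ]
      (Fin (d i + 1).toNat → ℂ)) (P : ℂ × ℂ → ℂ),
      Function.Injective M ∧
      (∀ f, (∀ j (h : G.Adj i j), d j < 0 → evalForm _ (node i j h).1 (node i j h).2 f = 0) →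
        ∃ g, M g = f) ∧
      (∀ g, ∀ j (h : G.Adj i j), d j < 0 → evalForm _ (node i j h).1 (node i j h).2 (M g) = 0) ∧
      (∀ j (h : G.Adj i j), 0 ≤ d j → P (node i j h) ≠ 0) ∧
      ∀ g (q : ℂ × ℂ), evalForm _ q.1 q.2 (M g) = P q * evalForm _ q.1 q.2 g := by
    intro i
    let p : I → ℂ × ℂ := fun j => if h : G.Adj i j then node i j h else 0
    have hp : ∀ j (h : G.Adj i j), p j = node i j h := fun j h => dif_pos h
    obtain ⟨M, P, h1, h2, h3, h4, h5⟩ := vanish p (d i + 1).toNat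
      (Finset.univ.filter fun j => G.Adj i j ∧ d j < 0)
      (by
        intro j hj
        simp only [Finset.mem_filter, Finset.mem_univ, true_and] at hj
        rw [hp j hj.1]; exact hnode.1 _ _ _)
      (by
        intro j hj j' hj' hne
        simp only [Finset.mem_filter, Finset.mem_univ, true_and] at hj hj'
        rw [hp j hj.1, hp j' hj'.1]; exact hnode.2 _ _ _ _ _ hne)
      (d i - (eNeg G d i : ℤ) + 1).toNat
      (by
        change _ = _ - eNeg G d i
        omega)
    refine ⟨M, P, h1, ?_, ?_, ?_, h5⟩
    · intro f hf
      apply h2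
      intro j hj
      simp only [Finset.mem_filter, Finset.mem_univ, true_and] at hj
      rw [hp j hj.1]; exact hf j hj.1 hj.2
    · intro g j h hj
      rw [← hp j h]
      exact h3 g j (by simp [h, hj])
    · intro j h hj
      apply h4
      intro j' hj'
      simp only [Finset.mem_filter, Finset.mem_univ, true_and] at hj'
      rw [hp j' hj'.1]
      exact hnode.2 _ _ _ _ _ (by rintro rfl; omega)
  choose M P hinj hsurj hvan hP hev using hV
  obtain ⟨c, hc, hcw⟩ := exists_scale hG
    (fun i j => if h : G.Adj i j then (if 0 ≤ d i ∧ 0 ≤ d j then P i (node i j h) else 1) else 1)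
    (by
      intro i j h
      simp only [h, dif_pos]
      split_ifs with h'
      · exact hP i j h h'.2
      · exact one_ne_zero)
  have hcw' : ∀ i j (h : G.Adj i j), 0 ≤ d i → 0 ≤ d j →
      c i * P i (node i j h) = c j * P j (node j i h.symm) := by
    intro i j h hi hj
    have := hcw i j h
    simpa [h, h.symm, hi, hj] using this
  let Φ : (∀ k : {i : I // 0 ≤ d i}, Fin (d k.1 - (eNeg G d k.1 : ℤ) + 1).toNat → ℂ) →ₗ[ℂ]
      (∀ k : I, Fin (d k + 1).toNat → ℂ) :=
    LinearMap.pi fun k => if h : 0 ≤ d k then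
      c k • (M k ∘ₗ LinearMap.proj (⟨k, h⟩ : {i : I // 0 ≤ d i})) else 0
  have hΦ : ∀ t k (h : 0 ≤ d k), Φ t k = c k • M k (t ⟨k, h⟩) := by
    intro t k h
    simp [Φ, h]
  have hΦ0 : ∀ t k, d k < 0 → Φ t k = 0 := by
    intro t k h
    simp [Φ, not_le.2 h]
  have hΦinj : Function.Injective Φ := by
    intro t t' h
    funext k
    have := congrFun h k.1
    rw [hΦ _ _ k.2, hΦ _ _ k.2] at this
    exact hinj _ (smul_right_injective _ (hc _) this)
  have hneg : ∀ k, d k < 0 → ∀ f : Fin (d k + 1).toNat → ℂ, f = 0 := by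
    intro k hk f
    funext x
    exact absurd x.2 (by omega)
  have hmap : nodalSections G (fun i => (d i + 1).toNat) node =
      (nodalSections (G.comap (Subtype.val : {i : I // 0 ≤ d i} → I))
              (fun i => (d i.1 - (eNeg G d i.1 : ℤ) + 1).toNat)
              (fun i j h => node i.1 j.1 h)).map Φ := by
    apply le_antisymm
    · intro s hs
      rw [mem_nodal] at hs
      have hg : ∀ k : I, ∃ g, M k g = s k := by
        intro k
        apply hsurj
        intro j h hj
        have := hs k j h
        rw [hneg j hj (s j), map_zero] at this
        exact this
      choose g hg using hg
      refine ⟨fun k => (c k.1)⁻¹ • g k.1, ?_, ?_⟩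
      · rw [SetLike.mem_coe, mem_nodal]
        rintro ⟨i, hi⟩ ⟨j, hj⟩ h
        have h : G.Adj i j := h
        have h1 := hs i j h
        rw [← hg i, ← hg j, hev, hev] at h1
        have h2 := hcw' i j h hi hj
        have h3 := hP i j h hj
        have h4 := hP j i h.symm hi
        have h5 := hc i
        have h6 := hc j
        rw [map_smul, map_smul, smul_eq_mul, smul_eq_mul]
        have h7 : c i * P i (node i j h) ≠ 0 := mul_ne_zero h5 h3
        apply mul_left_cancel₀ h7
        conv_rhs => rw [h2]
        field_simp
        exact h1
      · funext k
        by_cases hk : 0 ≤ d k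
        · rw [hΦ _ _ hk]
          simp only [map_smul]
          rw [smul_inv_smul₀ (hc k), hg]
        · rw [hΦ0 _ _ (not_le.1 hk)]
          exact (hneg k (not_le.1 hk) _).symm
    · rintro _ ⟨t, ht, rfl⟩
      rw [SetLike.mem_coe, mem_nodal] at ht
      rw [mem_nodal]
      intro i j h
      have aux : ∀ i j (h : G.Adj i j), d j < 0 →
          evalForm (d i + 1).toNat (node i j h).1 (node i j h).2 (Φ t i) = 0 := by
        intro i j h hj
        by_cases hi : 0 ≤ d i
        · rw [hΦ _ _ hi, map_smul, hvan _ _ _ _ hj, smul_zero]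
        · rw [hΦ0 _ _ (not_le.1 hi), map_zero]
      by_cases hi : 0 ≤ d i
      · by_cases hj : 0 ≤ d j
        · have h1 := ht ⟨i, hi⟩ ⟨j, hj⟩ h
          rw [hΦ _ _ hi, hΦ _ _ hj, map_smul, map_smul, hev, hev, smul_eq_mul, smul_eq_mul,
            ← mul_assoc, ← mul_assoc, hcw' i j h hi hj]
          congr 1
        · rw [aux i j h (not_le.1 hj), hΦ0 _ _ (not_le.1 hj), map_zero]
      · rw [aux j i h.symm (not_le.1 hi), hΦ0 _ _ (not_le.1 hi), map_zero]
  rw [hmap]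
  exact (Submodule.equivMapOfInjective Φ hΦinj _).finrank_eq.symm

/-- ordered adjacent pairs -/
lemma two_edges {V : Type*} [Fintype V] (H : SimpleGraph V) [DecidableRel H.Adj] :
    ∑ i, ∑ j, (if H.Adj i j then (1:ℤ) else 0) = 2 * Nat.card H.edgeSet := by
  classical
  have := H.sum_degrees_eq_twice_card_edges
  rw [Nat.card_eq_fintype_card, ← SimpleGraph.edgeFinset_card]
  rw [← Nat.cast_two, ← Nat.cast_mul, ← this]
  push_cast
  refine Finset.sum_congr rfl fun i _ => ?_
  rw [← SimpleGraph.card_neighborFinset_eq_degree, SimpleGraph.neighborFinset_eq_filter]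
  simp

theorem statement15 {I : Type} [Fintype I] [DecidableEq I]
    (G : SimpleGraph I) [DecidableRel G.Adj] (hG : G.IsTree) (d : I → ℤ)
    (node : ∀ i j, G.Adj i j → ℂ × ℂ) (hnode : NodesOk G node)
    (hdeg : -1 ≤ ∑ i, d i) :
    (Module.finrank ℂ ↥(nodalSections G (fun i => (d i + 1).toNat) node) : ℤ)
        = (∑ i, d i) + 1
      ↔ ((Module.finrank ℂ
            ↥(nodalSections (G.comap (Subtype.val : {i : I // 0 ≤ d i} → I))
              (fun i => (d i.1 - (eNeg G d i.1 : ℤ) + 1).toNat)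
              (fun i j h => node i.1 j.1 h)) : ℤ)
          = (∑ i : {i : I // 0 ≤ d i}, (d i.1 - (eNeg G d i.1 : ℤ)))
            + Nat.card
                (G.comap (Subtype.val : {i : I // 0 ≤ d i} → I)).ConnectedComponent)
        ∧ ((∀ i, -1 ≤ d i) ∧ ∀ i j, G.Adj i j → d i < 0 → ¬ d j < 0) := by
  classical
  rw [finrank_eq G hG d node hnode]
  have hb := dim_bound (G.comap (Subtype.val : {i : I // 0 ≤ d i} → I))
    (fun i => (d i.1 - (eNeg G d i.1 : ℤ) + 1).toNat) (fun i j h => node i.1 j.1 h)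
  have hf := forest_count (G.comap (Subtype.val : {i : I // 0 ≤ d i} → I))
    (hG.isAcyclic.of_comap (Function.Embedding.subtype _))
  have hpair := two_edges (G.comap (Subtype.val : {i : I // 0 ≤ d i} → I))
  have hpairG := two_edges G
  have hcard : (Nat.card G.edgeSet : ℤ) + 1 = Fintype.card I := by
    have := hG.card_edgeFinset
    rw [Nat.card_eq_fintype_card, ← SimpleGraph.edgeFinset_card]
    exact_mod_cast this
  generalize Module.finrank ℂ
            ↥(nodalSections (G.comap (Subtype.val : {i : I // 0 ≤ d i} → I))
              (fun i => (d i.1 - (eNeg G d i.1 : ℤ) + 1).toNat)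
              (fun i j h => node i.1 j.1 h)) = h0 at *
  generalize Nat.card
                (G.comap (Subtype.val : {i : I // 0 ≤ d i} → I)).ConnectedComponent = k at *
  generalize Nat.card
                (G.comap (Subtype.val : {i : I // 0 ≤ d i} → I)).edgeSet = E at *
  generalize Nat.card G.edgeSet = EG at *
  -- sums
  have sub : ∀ f : I → ℤ, ∑ i : {i : I // 0 ≤ d i}, f i.1 = ∑ i, if 0 ≤ d i then f i else 0 := by
    intro f
    rw [← Finset.sum_filter]
    exact (Finset.sum_subtype _ (by simp) f).symm
  have hb' : ∑ i : {i : I // 0 ≤ d i}, (d i.1 - (eNeg G d i.1 : ℤ) + 1) ≤ h0 + E := by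
    calc _ ≤ ∑ i : {i : I // 0 ≤ d i}, (((d i.1 - (eNeg G d i.1 : ℤ) + 1).toNat : ℕ) : ℤ) :=
          Finset.sum_le_sum fun i _ => Int.self_le_toNat _
      _ ≤ _ := by exact_mod_cast hb
  have hcp : (Fintype.card {i : I // 0 ≤ d i} : ℤ) = ∑ i, if 0 ≤ d i then 1 else 0 := by
    rw [← sub (fun _ => 1)]; simp
  have hcI : (Fintype.card I : ℤ) = ∑ i : I, 1 := by simp
  have hcn : (∑ i : I, (1:ℤ)) = (∑ i, if 0 ≤ d i then 1 else 0) + ∑ i, if d i < 0 then 1 else 0 := by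
    rw [← Finset.sum_add_distrib]
    exact Finset.sum_congr rfl fun i _ => by split_ifs <;> omega
  have he : ∀ i, (eNeg G d i : ℤ) = ∑ j, if G.Adj i j ∧ d j < 0 then 1 else 0 := by
    intro i; simp [eNeg]
  have hpair' : ∑ i, ∑ j, (if G.Adj i j ∧ 0 ≤ d i ∧ 0 ≤ d j then (1:ℤ) else 0) = 2 * E := by
    rw [← hpair]
    simp only [SimpleGraph.comap_adj]
    rw [sub (fun i => ∑ j : {i : I // 0 ≤ d i}, if G.Adj i j.1 then (1:ℤ) else 0)]
    refine Finset.sum_congr rfl fun i _ => ?_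
    rw [sub (fun j => if G.Adj i j then (1:ℤ) else 0)]
    split_ifs with hi
    · exact Finset.sum_congr rfl fun j _ => by split_ifs <;> tauto
    · exact Finset.sum_eq_zero fun j _ => by simp [hi]
  have hsplit : 2 * (EG : ℤ) = 2 * E +
      (∑ i, ∑ j, (if G.Adj i j ∧ 0 ≤ d i ∧ d j < 0 then (1:ℤ) else 0)) +
      (∑ i, ∑ j, (if G.Adj i j ∧ d i < 0 ∧ 0 ≤ d j then (1:ℤ) else 0)) +
      (∑ i, ∑ j, (if G.Adj i j ∧ d i < 0 ∧ d j < 0 then (1:ℤ) else 0)) := by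
    rw [← hpairG, ← hpair']
    simp only [← Finset.sum_add_distrib]
    refine Finset.sum_congr rfl fun i _ => Finset.sum_congr rfl fun j _ => ?_
    by_cases h1 : G.Adj i j <;> by_cases h2 : d i < 0 <;> by_cases h3 : d j < 0 <;>
      simp [h1, h2, h3, not_le.2, not_lt.1]
  have hsym : (∑ i, ∑ j, (if G.Adj i j ∧ d i < 0 ∧ 0 ≤ d j then (1:ℤ) else 0)) =
      ∑ i, ∑ j, (if G.Adj i j ∧ 0 ≤ d i ∧ d j < 0 then (1:ℤ) else 0) := by
    rw [Finset.sum_comm]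
    refine Finset.sum_congr rfl fun i _ => Finset.sum_congr rfl fun j _ => ?_
    have := G.adj_comm i j
    split_ifs <;> tauto
  have hes : ∑ i : {i : I // 0 ≤ d i}, (eNeg G d i.1 : ℤ) =
      ∑ i, ∑ j, (if G.Adj i j ∧ 0 ≤ d i ∧ d j < 0 then (1:ℤ) else 0) := by
    rw [sub (fun i => (eNeg G d i : ℤ))]
    refine Finset.sum_congr rfl fun i _ => ?_
    rw [he]
    split_ifs with hi
    · simp [hi]
    · simp [hi]
  have hds : ∑ i, d i = (∑ i : {i : I // 0 ≤ d i}, d i.1) + ∑ i, (if d i < 0 then d i else 0) := by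
    rw [sub d, ← Finset.sum_add_distrib]
    exact Finset.sum_congr rfl fun i _ => by split_ifs <;> omega
  -- defects
  have hD : (∑ i, if d i < 0 then (-1 - d i) else 0) =
      - (∑ i, if d i < 0 then 1 else 0) - ∑ i, (if d i < 0 then d i else 0) := by
    rw [← Finset.sum_neg_distrib, ← Finset.sum_sub_distrib]
    exact Finset.sum_congr rfl fun i _ => by split_ifs <;> omega
  have hDn : ∀ i ∈ Finset.univ, 0 ≤ (if d i < 0 then (-1 - d i) else 0) := by
    intro i _; split_ifs <;> omega
  have hD0 := Finset.sum_nonneg hDn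
  have hNn : ∀ i ∈ Finset.univ, 0 ≤ ∑ j, (if G.Adj i j ∧ d i < 0 ∧ d j < 0 then (1:ℤ) else 0) :=
    fun i _ => Finset.sum_nonneg fun j _ => by split_ifs <;> omega
  have hN0 := Finset.sum_nonneg hNn
  have hii : ((∀ i, -1 ≤ d i) ∧ ∀ i j, G.Adj i j → d i < 0 → ¬ d j < 0) ↔
      (∑ i, if d i < 0 then (-1 - d i) else 0) = 0 ∧
      (∑ i, ∑ j, (if G.Adj i j ∧ d i < 0 ∧ d j < 0 then (1:ℤ) else 0)) = 0 := by
    rw [Finset.sum_eq_zero_iff_of_nonneg hDn, Finset.sum_eq_zero_iff_of_nonneg hNn]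
    refine and_congr ?_ ?_
    · refine forall_congr' fun i => ?_
      simp only [Finset.mem_univ, true_imp_iff]
      split_ifs <;> omega
    · refine forall_congr' fun i => ?_
      simp only [Finset.mem_univ, true_imp_iff]
      rw [Finset.sum_eq_zero_iff_of_nonneg (fun j _ => by split_ifs <;> omega)]
      refine forall_congr' fun j => ?_
      simp
  rw [hii]
  simp only [Finset.sum_add_distrib, Finset.sum_sub_distrib] at hb' ⊢
  simp only [Finset.sum_const, Finset.card_univ, nsmul_eq_mul, mul_one] at hb'
  have hf' : (E : ℤ) + k = Fintype.card {i : I // 0 ≤ d i} := by exact_mod_cast hf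
  omega
end

section
/- Let A be the 7×10 matrix of the QSM jumping circuit in bottom-up coordinates with descent data (λ_1, λ_4, λ_5, λ_7) = (λ_1, λ_1(λ_7+1)/(λ_7(λ_1+1)), λ_1^2(λ_7+1)/(λ_1+1), λ_7) for λ_1, λ_7 ∈ C \ {−1, 0}. Then all 7×7 minors of A vanish (so the null space jumps from dimension 3 to dimension 4) if and only if the node parameters satisfy a = (λ_1+1)/λ_1 and b = λ_7 + 1. -/
/-- The 7×10 gluing matrix of a multidegree `(1,2,2,1)` line bundle on the circuit of
four ℙ¹'s, with node positions `a, b` and descent data `λ₁, λ₄, λ₅, λ₇`. -/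
noncomputable def circuitMatrix (a b l1 l4 l5 l7 : ℂ) : Matrix (Fin 7) (Fin 10) ℂ :=
  !![l1, 0, -1, 0, 0, 0, 0, 0, 0, 0;
     1, 1, 0, 0, 0, -1, 0, 0, 0, 0;
     0, 1, 0, 0, 0, 0, 0, 0, -1, 0;
     0, 0, 1, 1, 1, -l4, -l4, -l4, 0, 0;
     0, 0, 0, 0, 1, 0, 0, -l5, 0, 0;
     0, 0, 1, a, a ^ 2, 0, 0, 0, -1, -1;
     0, 0, 0, 0, 0, 1, b, b ^ 2, 0, -l7]

/-- The column relations satisfied by a left null vector. -/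
theorem cm_vecMul (a b l1 l4 l5 l7 : ℂ) (y : Fin 7 → ℂ) (j : Fin 10) :
    (Matrix.vecMul y (circuitMatrix a b l1 l4 l5 l7)) j =
      ![l1 * y 0 + y 1, y 1 + y 2, -y 0 + y 3 + y 5, y 3 + a * y 5,
        y 3 + y 4 + a ^ 2 * y 5, -y 1 - l4 * y 3 + y 6, -l4 * y 3 + b * y 6,
        -l4 * y 3 - l5 * y 4 + b ^ 2 * y 6, -y 2 - y 5, -y 5 - l7 * y 6] j := by
  fin_cases j <;>
    simp [Matrix.vecMul, dotProduct, Fin.sum_univ_succ, circuitMatrix] <;> ring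

theorem cm_solve (l1 l7 : ℂ) (h70 : l7 ≠ 0) (a : ℂ) (y : Fin 7 → ℂ)
    (e0 : l1 * y 0 + y 1 = 0) (e1 : y 1 + y 2 = 0) (e2 : -y 0 + y 3 + y 5 = 0)
    (e4 : y 3 + y 4 + a ^ 2 * y 5 = 0) (e8 : -y 2 - y 5 = 0) (e9 : -y 5 - l7 * y 6 = 0) :
    y = y 0 • ![1, -l1, l1, 1 + l1, a ^ 2 * l1 - (1 + l1), -l1, l1 / l7] := by
  have h1 : y 1 = y 0 * -l1 := by linear_combination e0
  have h2 : y 2 = y 0 * l1 := by linear_combination e1 - h1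
  have h5 : y 5 = y 0 * -l1 := by linear_combination -e8 - h2
  have h3 : y 3 = y 0 * (1 + l1) := by linear_combination e2 - h5
  have h4 : y 4 = y 0 * (a ^ 2 * l1 - (1 + l1)) := by
    linear_combination e4 - h3 - a ^ 2 * h5
  have h6 : y 6 = y 0 * (l1 / l7) := by
    field_simp
    linear_combination -e9 - h5
  funext i
  fin_cases i
  · simp
  · simpa using h1
  · simpa using h2
  · simpa using h3
  · simpa using h4
  · simpa using h5
  · simpa using h6

theorem cm_minor (M : Matrix (Fin 7) (Fin 10) ℂ) (c : Fin 7 → Fin 10)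
    (h : (M.submatrix id c).det = 0) :
    ∃ y : Fin 7 → ℂ, y ≠ 0 ∧ ∀ i, (Matrix.vecMul y M) (c i) = 0 := by
  obtain ⟨y, hy, h⟩ := Matrix.exists_vecMul_eq_zero_iff.mpr h
  exact ⟨y, hy, fun i => congrFun h i⟩

theorem cm_finrank (M : Matrix (Fin 7) (Fin 10) ℂ) :
    Module.finrank ℂ (LinearMap.ker M.mulVecLin) =
      3 + Module.finrank ℂ (LinearMap.ker M.transpose.mulVecLin) := by
  have h1 := M.mulVecLin.finrank_range_add_finrank_ker
  have h2 := M.transpose.mulVecLin.finrank_range_add_finrank_ker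
  have h3 := M.rank_transpose
  simp only [Matrix.rank] at h3
  simp only [Module.finrank_fin_fun] at h1 h2
  omega

/-- With descent data
`(λ₁, λ₄, λ₅, λ₇) = (λ₁, λ₁(λ₇+1)/(λ₇(λ₁+1)), λ₁²(λ₇+1)/(λ₁+1), λ₇)` for
`λ₁, λ₇ ∈ ℂ \ {-1, 0}`, all 7×7 minors of the circuit matrix vanish — so the null
space jumps from dimension 3 to dimension 4 — iff the node parameters satisfy
`a = (λ₁+1)/λ₁` and `b = λ₇+1`. -/
theorem statement18 (a b l1 l7 : ℂ)
    (ha0 : a ≠ 0) (ha1 : a ≠ 1) (hb0 : b ≠ 0) (hb1 : b ≠ 1)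
    (h10 : l1 ≠ 0) (h1m : l1 ≠ -1) (h70 : l7 ≠ 0) (h7m : l7 ≠ -1) :
    ((∀ c : Fin 7 → Fin 10, Function.Injective c →
        ((circuitMatrix a b l1 (l1 * (l7 + 1) / (l7 * (l1 + 1)))
            (l1 ^ 2 * (l7 + 1) / (l1 + 1)) l7).submatrix id c).det = 0)
      ↔ (a = (l1 + 1) / l1 ∧ b = l7 + 1))
    ∧ ((a = (l1 + 1) / l1 ∧ b = l7 + 1) →
        Module.finrank ℂ
          ↥(LinearMap.ker (circuitMatrix a b l1 (l1 * (l7 + 1) / (l7 * (l1 + 1)))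
              (l1 ^ 2 * (l7 + 1) / (l1 + 1)) l7).mulVecLin) = 4)
    ∧ (¬ (a = (l1 + 1) / l1 ∧ b = l7 + 1) →
        Module.finrank ℂ
          ↥(LinearMap.ker (circuitMatrix a b l1 (l1 * (l7 + 1) / (l7 * (l1 + 1)))
              (l1 ^ 2 * (l7 + 1) / (l1 + 1)) l7).mulVecLin) = 3) := by
  have h1p : l1 + 1 ≠ 0 := fun h => h1m (eq_neg_of_add_eq_zero_left h)
  set l4 := l1 * (l7 + 1) / (l7 * (l1 + 1)) with hl4
  set l5 := l1 ^ 2 * (l7 + 1) / (l1 + 1) with hl5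
  -- a null vector supported on the common columns has nonzero first entry
  have key : ∀ y : Fin 7 → ℂ, y ≠ 0 →
      y = y 0 • ![1, -l1, l1, 1 + l1, a ^ 2 * l1 - (1 + l1), -l1, l1 / l7] → y 0 ≠ 0 := by
    intro y hy h h0
    rw [h0, zero_smul] at h
    exact hy h
  have getA : ∀ y : Fin 7 → ℂ, y 0 ≠ 0 →
      y = y 0 • ![1, -l1, l1, 1 + l1, a ^ 2 * l1 - (1 + l1), -l1, l1 / l7] →
      y 3 + a * y 5 = 0 → a = (l1 + 1) / l1 := by
    intro y h0 h e
    have h3 : y 3 = y 0 * (1 + l1) := by simpa using congrFun h 3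
    have h5 : y 5 = y 0 * -l1 := by simpa using congrFun h 5
    rw [h3, h5] at e
    rw [eq_div_iff h10]
    apply mul_left_cancel₀ h0
    linear_combination -e
  have getB : ∀ y : Fin 7 → ℂ, y 0 ≠ 0 →
      y = y 0 • ![1, -l1, l1, 1 + l1, a ^ 2 * l1 - (1 + l1), -l1, l1 / l7] →
      -l4 * y 3 + b * y 6 = 0 → b = l7 + 1 := by
    intro y h0 h e
    have h3 : y 3 = y 0 * (1 + l1) := by simpa using congrFun h 3
    have h6 : y 6 = y 0 * (l1 / l7) := by simpa using congrFun h 6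
    rw [h3, h6, hl4] at e
    have e' : y 0 * l1 * (b - (l7 + 1)) = 0 := by
      field_simp at e
      apply mul_left_cancel₀ h1p
      linear_combination e
    rcases mul_eq_zero.mp e' with e' | e'
    · exact absurd e' (mul_ne_zero h0 h10)
    · exact sub_eq_zero.mp e'
  have nullv : (a = (l1 + 1) / l1 ∧ b = l7 + 1) →
      Matrix.vecMul ![1, -l1, l1, 1 + l1, a ^ 2 * l1 - (1 + l1), -l1, l1 / l7]
        (circuitMatrix a b l1 l4 l5 l7) = 0 := by
    rintro ⟨rfl, rfl⟩
    funext j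
    rw [cm_vecMul, hl4, hl5]
    fin_cases j <;> simp <;> field_simp <;> ring
  have vne : ![1, -l1, l1, 1 + l1, a ^ 2 * l1 - (1 + l1), -l1, l1 / l7] ≠ 0 := by
    intro h
    simpa using congrFun h 0
  have full : ∀ y : Fin 7 → ℂ, Matrix.vecMul y (circuitMatrix a b l1 l4 l5 l7) = 0 →
      y = y 0 • ![1, -l1, l1, 1 + l1, a ^ 2 * l1 - (1 + l1), -l1, l1 / l7] := by
    intro y h
    have hc : ∀ j, _ := fun j => (cm_vecMul a b l1 l4 l5 l7 y j).symm.trans (congrFun h j)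
    exact cm_solve l1 l7 h70 a y (hc 0) (hc 1) (hc 2) (hc 4) (hc 8) (hc 9)
  refine ⟨⟨fun H => ⟨?_, ?_⟩, ?_⟩, ?_, ?_⟩
  · obtain ⟨y, hy, h⟩ := cm_minor _ _ (H ![0, 1, 2, 3, 4, 8, 9] (by decide))
    have hc : ∀ i, _ := fun i => (cm_vecMul a b l1 l4 l5 l7 y _).symm.trans (h i)
    have hs := cm_solve l1 l7 h70 a y (hc 0) (hc 1) (hc 2) (hc 4) (hc 5) (hc 6)
    exact getA y (key y hy hs) hs (hc 3)
  · obtain ⟨y, hy, h⟩ := cm_minor _ _ (H ![0, 1, 2, 6, 4, 8, 9] (by decide))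
    have hc : ∀ i, _ := fun i => (cm_vecMul a b l1 l4 l5 l7 y _).symm.trans (h i)
    have hs := cm_solve l1 l7 h70 a y (hc 0) (hc 1) (hc 2) (hc 4) (hc 5) (hc 6)
    exact getB y (key y hy hs) hs (hc 3)
  · intro hab c _
    apply Matrix.exists_vecMul_eq_zero_iff.mp
    exact ⟨_, vne, funext fun i => congrFun (nullv hab) (c i)⟩
  · intro hab
    rw [cm_finrank]
    have : LinearMap.ker (circuitMatrix a b l1 l4 l5 l7).transpose.mulVecLin =
        Submodule.span ℂ
          {![1, -l1, l1, 1 + l1, a ^ 2 * l1 - (1 + l1), -l1, l1 / l7]} := by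
      ext y
      rw [LinearMap.mem_ker, Matrix.mulVecLin_apply, Matrix.mulVec_transpose,
        Submodule.mem_span_singleton]
      constructor
      · intro h
        exact ⟨y 0, (full y h).symm⟩
      · rintro ⟨t, rfl⟩
        rw [Matrix.smul_vecMul, nullv hab, smul_zero]
    rw [this, finrank_span_singleton vne]
  · intro hab
    rw [cm_finrank]
    have : LinearMap.ker (circuitMatrix a b l1 l4 l5 l7).transpose.mulVecLin = ⊥ := by
      rw [LinearMap.ker_eq_bot']
      intro y h
      rw [Matrix.mulVecLin_apply, Matrix.mulVec_transpose] at h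
      by_contra hy
      have hs := full y h
      have hc : ∀ j, _ := fun j => (cm_vecMul a b l1 l4 l5 l7 y j).symm.trans (congrFun h j)
      have h0 := key y hy hs
      exact hab ⟨getA y h0 hs (hc 3), getB y h0 hs (hc 6)⟩
    rw [this, finrank_bot]
end
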